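/- arXiv:1407.5651 — 3 statements merged into one kernel-verified Lean document; each statement's English description precedes it below -/
import Mathlib

section
/- For every choice of positive rate constants k1,…,k30 and every x ∈ ℝ^21, the mass action vector field of Net2 vanishes at x (f(x) = 0) if and only if the following 15 binomials all vanish at x: (k2+k3)x12 − k1·x1·x9, (k5+k6)x17 − k4·x2·x10, k3·x12 − k6·x17, (k8+k9)x13 − k7·x2·x3, (k17+k18)x19 − k16·x4·x11, k9·x13 − k18·x19, (k11+k12)x14 − k10·x2·x4, (k14+k15)x18 − k13·x5·x11, k12·x14 − k15·x18, (k20+k21)x15 − k19·x5·x6, (k29+k30)x21 − k28·x7·x11, k21·x15 − k30·x21, (k23+k24)x16 − k22·x5·x7, (k26+k27)x20 − k25·x8·x11, k24·x16 − k27·x20. -/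
/-- The `j`-th standard basis vector of `ℕ^21`. -/
def ee (j : Fin 21) : Fin 21 → ℕ := fun i => if i = j then 1 else 0

/-- The 10 motifs `A + B ⇄ C → D + B` of Net2, recorded as tuples `(A, B, C, D)`
(0-based species indices, so `Xⱼ` is index `j - 1`). -/
def motifs2 : Fin 10 → Fin 21 × Fin 21 × Fin 21 × Fin 21 :=
  ![(0, 8, 11, 1),
    (1, 9, 16, 0),
    (2, 1, 12, 3),
    (3, 1, 13, 4),
    (4, 10, 17, 3),
    (3, 10, 18, 2),
    (5, 4, 14, 6),
    (6, 4, 15, 7),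
    (7, 10, 19, 6),
    (6, 10, 20, 5)]

/-- Exponent vector of the source complex of the `i`-th reaction of Net2
(motif `i / 3`; reactions `A+B → C`, `C → A+B`, `C → D+B`). -/
def src2 (i : Fin 30) : Fin 21 → ℕ :=
  let m := motifs2 ⟨i.val / 3, by have := i.isLt; omega⟩
  if i.val % 3 = 0 then ee m.1 + ee m.2.1 else ee m.2.2.1

/-- Exponent vector of the product complex of the `i`-th reaction of Net2. -/
def tgt2 (i : Fin 30) : Fin 21 → ℕ :=
  let m := motifs2 ⟨i.val / 3, by have := i.isLt; omega⟩
  if i.val % 3 = 0 then ee m.2.2.1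
  else if i.val % 3 = 1 then ee m.1 + ee m.2.1
  else ee m.2.2.2 + ee m.2.1

/-- The mass action vector field of Net2: `f(x)ⱼ = Σᵢ kᵢ x^{yᵢ} ((yᵢ')ⱼ − (yᵢ)ⱼ)`. -/
def massAction2 (k : Fin 30 → ℝ) (x : Fin 21 → ℝ) : Fin 21 → ℝ :=
  fun j => ∑ i : Fin 30,
    k i * (∏ l : Fin 21, x l ^ src2 i l) * ((tgt2 i j : ℝ) - (src2 i j : ℝ))

theorem prod_ee (x : Fin 21 → ℝ) (a : Fin 21) : ∏ l : Fin 21, x l ^ ee a l = x a := by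
  simp [ee, pow_ite]

theorem prod_ee_add (x : Fin 21 → ℝ) (a b : Fin 21) :
    ∏ l : Fin 21, x l ^ (ee a + ee b) l = x a * x b := by
  simp only [Pi.add_apply, pow_add, Finset.prod_mul_distrib, prod_ee]

/-- Contribution of one motif to the vector field. -/
def mot (x : Fin 21 → ℝ) (p q r : ℝ) (a b c d : Fin 21) (j : Fin 21) : ℝ :=
  (p * (x a * x b) - q * x c) * ((ee c j : ℝ) - ee a j - ee b j)
    + r * x c * ((ee d j : ℝ) + ee b j - ee c j)

theorem sum30 (f : Fin 30 → ℝ) : ∑ i, f i = ∑ m : Fin 10,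
    (f ⟨3 * m.val, by omega⟩ + f ⟨3 * m.val + 1, by omega⟩ + f ⟨3 * m.val + 2, by omega⟩) := by
  simp only [Fin.sum_univ_succ, Fin.sum_univ_zero]
  simp [Fin.succ]
  ring

theorem massAction2_eq (k : Fin 30 → ℝ) (x : Fin 21 → ℝ) (j : Fin 21) :
    massAction2 k x j = ∑ m : Fin 10,
      mot x (k ⟨3 * m.val, by omega⟩) (k ⟨3 * m.val + 1, by omega⟩) (k ⟨3 * m.val + 2, by omega⟩)
        (motifs2 m).1 (motifs2 m).2.1 (motifs2 m).2.2.1 (motifs2 m).2.2.2 j := by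
  unfold massAction2
  rw [sum30]
  refine Finset.sum_congr rfl fun m _ => ?_
  have e0 : 3 * m.val / 3 = m.val := by omega
  have e1 : (3 * m.val + 1) / 3 = m.val := by omega
  have e2 : (3 * m.val + 2) / 3 = m.val := by omega
  have r0 : 3 * m.val % 3 = 0 := by omega
  have r1 : (3 * m.val + 1) % 3 = 1 := by omega
  have r2 : (3 * m.val + 2) % 3 = 2 := by omega
  simp only [src2, tgt2, e0, e1, e2, r0, r1, r2, Fin.eta, if_true, one_ne_zero, if_false,
    OfNat.ofNat_ne_zero, OfNat.ofNat_ne_one, prod_ee, Pi.add_apply, pow_add,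
    Finset.prod_mul_distrib, Nat.cast_add, mot]
  ring

theorem massAction2_explicit (k : Fin 30 → ℝ) (x : Fin 21 → ℝ) (j : Fin 21) :
    massAction2 k x j =
      mot x (k 0) (k 1) (k 2) 0 8 11 1 j +
      mot x (k 3) (k 4) (k 5) 1 9 16 0 j +
      mot x (k 6) (k 7) (k 8) 2 1 12 3 j +
      mot x (k 9) (k 10) (k 11) 3 1 13 4 j +
      mot x (k 12) (k 13) (k 14) 4 10 17 3 j +
      mot x (k 15) (k 16) (k 17) 3 10 18 2 j +
      mot x (k 18) (k 19) (k 20) 5 4 14 6 j +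
      mot x (k 21) (k 22) (k 23) 6 4 15 7 j +
      mot x (k 24) (k 25) (k 26) 7 10 19 6 j +
      mot x (k 27) (k 28) (k 29) 6 10 20 5 j := by
  rw [massAction2_eq]
  simp only [Fin.sum_univ_succ, Fin.sum_univ_zero, add_zero, ← add_assoc]
  rfl

/-- For every choice of positive rate constants and every `x ∈ ℝ^21`, the mass action
vector field of Net2 vanishes at `x` iff the 15 binomials vanish at `x`.
(Rate constant `kⱼ` of the paper is `k (j-1)` here, species `Xⱼ` is `x (j-1)`.) -/
theorem net2_steady_state_iff_binomials (k : Fin 30 → ℝ) (hk : ∀ i, 0 < k i)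
    (x : Fin 21 → ℝ) :
    massAction2 k x = 0 ↔
      (((k 1 + k 2) * x 11 - k 0 * (x 0 * x 8) = 0) ∧
      ((k 4 + k 5) * x 16 - k 3 * (x 1 * x 9) = 0) ∧
      (k 2 * x 11 - k 5 * x 16 = 0) ∧
      ((k 7 + k 8) * x 12 - k 6 * (x 1 * x 2) = 0) ∧
      ((k 16 + k 17) * x 18 - k 15 * (x 3 * x 10) = 0) ∧
      (k 8 * x 12 - k 17 * x 18 = 0) ∧
      ((k 10 + k 11) * x 13 - k 9 * (x 1 * x 3) = 0) ∧
      ((k 13 + k 14) * x 17 - k 12 * (x 4 * x 10) = 0) ∧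
      (k 11 * x 13 - k 14 * x 17 = 0) ∧
      ((k 19 + k 20) * x 14 - k 18 * (x 4 * x 5) = 0) ∧
      ((k 28 + k 29) * x 20 - k 27 * (x 6 * x 10) = 0) ∧
      (k 20 * x 14 - k 29 * x 20 = 0) ∧
      ((k 22 + k 23) * x 15 - k 21 * (x 4 * x 6) = 0) ∧
      ((k 25 + k 26) * x 19 - k 24 * (x 7 * x 10) = 0) ∧
      (k 23 * x 15 - k 26 * x 19 = 0)) := by
  constructor
  · intro h
    have H : ∀ j, massAction2 k x j = 0 := fun j => by rw [h]; rfl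
    simp only [massAction2_explicit] at H
    have h11 := H 11
    have h12 := H 12
    have h13 := H 13
    have h14 := H 14
    have h15 := H 15
    have h16 := H 16
    have h17 := H 17
    have h18 := H 18
    have h19 := H 19
    have h20 := H 20
    have h0 := H 0
    have h2 := H 2
    have h4 := H 4
    have h5 := H 5
    have h7 := H 7
    clear H h
    simp [mot, ee] at h11 h12 h13 h14 h15 h16 h17 h18 h19 h20 h0 h2 h4 h5 h7
    refine ⟨?_, ?_, ?_, ?_, ?_, ?_, ?_, ?_, ?_, ?_, ?_, ?_, ?_, ?_, ?_⟩ <;> linarith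
  · rintro ⟨h1, h2, h3, h4, h5, h6, h7, h8, h9, h10, h11, h12, h13, h14, h15⟩
    funext j
    rw [massAction2_explicit]
    fin_cases j <;> simp [mot, ee] <;> linarith
end

section
/- The ℝ-linear span in ℝ^21 of the 30 reaction vectors y_i' − y_i of Net2 (which coincide with the reaction vectors of its translation Tran2) has dimension exactly 15; since the translated network Tran2 has 20 complexes and 5 linkage classes, its deficiency equals 20 − 5 − 15 = 0. -/
/-- The reaction vector `yᵢ' − yᵢ ∈ ℝ^21` of the `i`-th reaction of Net2
(these coincide with the reaction vectors of the translation Tran2). -/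
def reactionVec2 (i : Fin 30) : Fin 21 → ℝ :=
  fun j => (tgt2 i j : ℝ) - (src2 i j : ℝ)

/-- Integer reaction vectors. -/
def rZ2 (i : Fin 30) (j : Fin 21) : ℤ := (tgt2 i j : ℤ) - (src2 i j : ℤ)

/-- Indices of the reactions `C → D + B` used for the last five basis vectors. -/
def pr2 : Fin 5 → Fin 10 := ![0, 2, 3, 6, 7]

/-- A basis of the stoichiometric subspace. -/
def bZ2 (k : Fin 15) (j : Fin 21) : ℤ :=
  if h : k.val < 10 then rZ2 ⟨3 * k.val, by omega⟩ j
  else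
    let m := pr2 ⟨k.val - 10, by omega⟩
    rZ2 ⟨3 * m.val, by omega⟩ j + rZ2 ⟨3 * m.val + 2, by omega⟩ j

/-- The last five dual functionals on the non-intermediate species. -/
def fb2 : Fin 5 → Fin 21 → ℤ :=
  ![fun j => if j = 1 then 1 else 0,
    fun j => if j = 3 ∨ j = 4 then 1 else 0,
    fun j => if j = 4 then 1 else 0,
    fun j => if j = 6 ∨ j = 7 then 1 else 0,
    fun j => if j = 7 then 1 else 0]

/-- Dual functionals. -/
def dZ2 (k : Fin 15) (j : Fin 21) : ℤ :=
  if h : k.val < 10 then (if j = (motifs2 ⟨k.val, h⟩).2.2.1 then 1 else 0)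
  else
    let f := fb2 ⟨k.val - 10, by omega⟩
    f j + ∑ m : Fin 10, if j = (motifs2 m).2.2.1 then
      f (motifs2 m).1 + f (motifs2 m).2.1 else 0

theorem dual2 : ∀ k l : Fin 15, ∑ j, dZ2 k j * bZ2 l j = if k = l then 1 else 0 := by
  decide +kernel

theorem expand2 : ∀ (i : Fin 30) (j : Fin 21),
    ∑ k, (∑ l, dZ2 k l * rZ2 i l) * bZ2 k j = rZ2 i j := by
  decide +kernel

/-- The real basis. -/
def bR2 (k : Fin 15) (j : Fin 21) : ℝ := (bZ2 k j : ℝ)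

theorem rvec2_eq (i : Fin 30) (j : Fin 21) : reactionVec2 i j = (rZ2 i j : ℝ) := by
  simp [reactionVec2, rZ2]

theorem bR2_indep : LinearIndependent ℝ bR2 := by
  rw [Fintype.linearIndependent_iff]
  intro g hg k
  have h1 : ∑ j, (dZ2 k j : ℝ) * (∑ l, g l • bR2 l) j = 0 := by rw [hg]; simp
  have h2 : ∀ l, ∑ j, (dZ2 k j : ℝ) * bR2 l j = if k = l then 1 else 0 := by
    intro l
    have := congrArg (Int.cast : ℤ → ℝ) (dual2 k l)
    push_cast at this
    exact this
  have h3 : ∑ j, (dZ2 k j : ℝ) * (∑ l, g l • bR2 l) j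
      = ∑ l, g l * ∑ j, (dZ2 k j : ℝ) * bR2 l j := by
    simp only [Finset.sum_apply, Pi.smul_apply, smul_eq_mul, Finset.mul_sum]
    rw [Finset.sum_comm]
    refine Finset.sum_congr rfl fun l _ => Finset.sum_congr rfl fun j _ => by ring
  rw [h3] at h1
  simpa [h2] using h1

theorem span2_eq : Submodule.span ℝ (Set.range reactionVec2)
    = Submodule.span ℝ (Set.range bR2) := by
  apply le_antisymm
  · rw [Submodule.span_le]
    rintro _ ⟨i, rfl⟩
    have : reactionVec2 i = ∑ k, ((∑ l, dZ2 k l * rZ2 i l : ℤ) : ℝ) • bR2 k := by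
      ext j
      rw [rvec2_eq, ← expand2 i j]
      simp only [Finset.sum_apply, Pi.smul_apply, smul_eq_mul, bR2]
      push_cast
      rfl
    rw [this]
    exact Submodule.sum_mem _ fun k _ =>
      Submodule.smul_mem _ _ (Submodule.subset_span ⟨k, rfl⟩)
  · rw [Submodule.span_le]
    rintro _ ⟨k, rfl⟩
    by_cases h : k.val < 10
    · have : bR2 k = reactionVec2 ⟨3 * k.val, by omega⟩ := by
        ext j
        rw [rvec2_eq]
        simp [bR2, bZ2, h]
      rw [this]
      exact Submodule.subset_span ⟨_, rfl⟩
    · have : bR2 k = reactionVec2 ⟨3 * (pr2 ⟨k.val - 10, by omega⟩).val, by omega⟩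
          + reactionVec2 ⟨3 * (pr2 ⟨k.val - 10, by omega⟩).val + 2, by omega⟩ := by
        ext j
        rw [Pi.add_apply, rvec2_eq, rvec2_eq]
        simp [bR2, bZ2, h]
      rw [this]
      exact Submodule.add_mem _ (Submodule.subset_span ⟨_, rfl⟩)
        (Submodule.subset_span ⟨_, rfl⟩)

/-- The ℝ-linear span of the 30 reaction vectors of Net2 (equivalently, of its
translation Tran2) has dimension exactly 15; since Tran2 has 20 complexes and 5
linkage classes, its deficiency is `20 - 5 - 15 = 0`. -/
theorem net2_stoichiometric_dimension_and_deficiency :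
    Module.finrank ℝ (Submodule.span ℝ (Set.range reactionVec2)) = 15 ∧
    20 - 5 - Module.finrank ℝ (Submodule.span ℝ (Set.range reactionVec2)) = 0 := by
  have h : Module.finrank ℝ (Submodule.span ℝ (Set.range reactionVec2)) = 15 := by
    rw [span2_eq, finrank_span_eq_card bR2_indep]
    simp
  exact ⟨h, by rw [h]⟩
end

section
/- Let v1,…,v20 ∈ ℕ^21 ⊂ ℝ^21 be the kinetic complexes of the translation Tran2 of Net2, grouped into five quadruples (per linkage class): (e1+e9, e12, e2+e10, e17), (e2+e3, e13, e4+e11, e19), (e2+e4, e14, e5+e11, e18), (e5+e6, e15, e7+e11, e21), (e5+e7, e16, e8+e11, e20), where e_j is the j-th standard basis vector. Within each quadruple (w1,w2,w3,w4) the edges of the translated reaction graph are w1→w2, w2→w1, w2→w3, w3→w4, w4→w3, w4→w1. Then the ℝ-linear span of all edge differences (target minus source, over all 30 edges) has dimension exactly 15; hence the kinetic-order deficiency of Tran2 is 20 − 5 − 15 = 0. -/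
/-- The `j`-th standard basis vector of `ℝ^21`. -/
def eR (j : Fin 21) : Fin 21 → ℝ := fun i => if i = j then 1 else 0

/-- The 20 kinetic complexes of the translation Tran2 of Net2 (as vectors in
`ℕ^21 ⊂ ℝ^21`), grouped into 5 quadruples, one per linkage class. `eR j` is the
standard basis vector of 0-based index `j`, i.e. the species `X(j+1)`. -/
def kinComplex2 : Fin 20 → Fin 21 → ℝ :=
  ![eR 0 + eR 8,
    eR 11,
    eR 1 + eR 9,
    eR 16,
    eR 1 + eR 2,
    eR 12,
    eR 3 + eR 10,
    eR 18,
    eR 1 + eR 3,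
    eR 13,
    eR 4 + eR 10,
    eR 17,
    eR 4 + eR 5,
    eR 14,
    eR 6 + eR 10,
    eR 20,
    eR 4 + eR 6,
    eR 15,
    eR 7 + eR 10,
    eR 19]

/-- The directed edges of the translated reaction graph of Tran2: within each quadruple
`(w₁, w₂, w₃, w₄)` the edges are `w₁→w₂, w₂→w₁, w₂→w₃, w₃→w₄, w₄→w₃, w₄→w₁`
(pairs are `(source, target)`). -/
def kinEdges2 : Fin 30 → Fin 20 × Fin 20 :=
  ![(0, 1), (1, 0), (1, 2), (2, 3), (3, 2), (3, 0), (4, 5), (5, 4), (5, 6), (6, 7), (7, 6), (7, 4), (8, 9), (9, 8), (9, 10), (10, 11), (11, 10), (11, 8), (12, 13), (13, 12), (13, 14), (14, 15), (15, 14), (15, 12), (16, 17), (17, 16), (17, 18), (18, 19), (19, 18), (19, 16)]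

/-- Difference of kinetic complexes along an edge: target minus source. -/
def kinEdgeDiff2 (i : Fin 30) : Fin 21 → ℝ :=
  kinComplex2 (kinEdges2 i).2 - kinComplex2 (kinEdges2 i).1

def selEdge2 : Fin 15 → Fin 30 :=
  ![0, 2, 3, 6, 8, 9, 12, 14, 15, 18, 20, 21, 24, 26, 27]

theorem span_sel2 : Submodule.span ℝ (Set.range kinEdgeDiff2) =
    Submodule.span ℝ (Set.range (fun i => kinEdgeDiff2 (selEdge2 i))) := by
  apply le_antisymm
  · rw [Submodule.span_le]
    have hs : ∀ i, kinEdgeDiff2 (selEdge2 i) ∈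
        Submodule.span ℝ (Set.range (fun i => kinEdgeDiff2 (selEdge2 i))) :=
      fun i => Submodule.subset_span ⟨i, rfl⟩
    generalize Submodule.span ℝ (Set.range (fun i => kinEdgeDiff2 (selEdge2 i))) = S at hs
    have neg : ∀ a b : Fin 20, kinComplex2 a - kinComplex2 b ∈ S →
        kinComplex2 b - kinComplex2 a ∈ S := by
      intro a b h
      have := S.neg_mem h
      rwa [neg_sub] at this
    have tri : ∀ a b c : Fin 20, kinComplex2 b - kinComplex2 a ∈ S →
        kinComplex2 c - kinComplex2 b ∈ S → kinComplex2 c - kinComplex2 a ∈ S := by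
      intro a b c h h'
      have := S.add_mem h' h
      rwa [sub_add_sub_cancel] at this
    rintro _ ⟨i, rfl⟩
    fin_cases i
    · exact hs 0
    · exact neg 1 0 (hs 0)
    · exact hs 1
    · exact hs 2
    · exact neg 3 2 (hs 2)
    · exact neg 3 0 (tri 0 1 3 (hs 0) (tri 1 2 3 (hs 1) (hs 2)))
    · exact hs 3
    · exact neg 5 4 (hs 3)
    · exact hs 4
    · exact hs 5
    · exact neg 7 6 (hs 5)
    · exact neg 7 4 (tri 4 5 7 (hs 3) (tri 5 6 7 (hs 4) (hs 5)))
    · exact hs 6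
    · exact neg 9 8 (hs 6)
    · exact hs 7
    · exact hs 8
    · exact neg 11 10 (hs 8)
    · exact neg 11 8 (tri 8 9 11 (hs 6) (tri 9 10 11 (hs 7) (hs 8)))
    · exact hs 9
    · exact neg 13 12 (hs 9)
    · exact hs 10
    · exact hs 11
    · exact neg 15 14 (hs 11)
    · exact neg 15 12 (tri 12 13 15 (hs 9) (tri 13 14 15 (hs 10) (hs 11)))
    · exact hs 12
    · exact neg 17 16 (hs 12)
    · exact hs 13
    · exact hs 14
    · exact neg 19 18 (hs 14)
    · exact neg 19 16 (tri 16 17 19 (hs 12) (tri 17 18 19 (hs 13) (hs 14)))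
  · apply Submodule.span_mono
    rintro _ ⟨i, rfl⟩
    exact ⟨_, rfl⟩

set_option maxHeartbeats 4000000 in
theorem linInd_sel2 : LinearIndependent ℝ (fun i => kinEdgeDiff2 (selEdge2 i)) := by
  rw [Fintype.linearIndependent_iff]
  intro c hc
  have h : ∀ j : Fin 21, ∑ i, c i * kinEdgeDiff2 (selEdge2 i) j = 0 := by
    intro j
    have := congrFun hc j
    simpa using this
  simp only [Fin.sum_univ_succ, Fin.sum_univ_zero] at h
  simp [kinEdgeDiff2, kinEdges2, kinComplex2, selEdge2, eR] at h
  have h0 := h 0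
  have h1 := h 1
  have h2 := h 2
  have h3 := h 3
  have h5 := h 5
  have h7 := h 7
  have h11 := h 11
  have h12 := h 12
  have h13 := h 13
  have h14 := h 14
  have h15 := h 15
  have h16 := h 16
  have h17 := h 17
  have h18 := h 18
  have h19 := h 19
  have h20 := h 20
  clear h hc
  simp at h0 h1 h2 h3 h5 h7 h11 h12 h13 h14 h15 h16 h17 h18 h19 h20
  intro i
  fin_cases i <;> simp <;> linarith

theorem tran2_kinetic_order_dimension_and_deficiency :
    Module.finrank ℝ (Submodule.span ℝ (Set.range kinEdgeDiff2)) = 15 ∧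
    20 - 5 - Module.finrank ℝ (Submodule.span ℝ (Set.range kinEdgeDiff2)) = 0 := by
  have h : Module.finrank ℝ (Submodule.span ℝ (Set.range kinEdgeDiff2)) = 15 := by
    rw [span_sel2, finrank_span_eq_card linInd_sel2]
    simp
  exact ⟨h, by rw [h]⟩
end
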